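/- The Prime Number Theorem in Chebyshev form: ψ(x) ∼ x as x → +∞, i.e. ψ(x)/x → 1 as x → +∞, where ψ(x) = ∑_{n < x} Λ(n) is the Chebyshev function. -/

import Mathlib

open MeasureTheory Set Filter

namespace PNTAux

open Complex Topology

/-- The normalised Chebyshev function. -/
noncomputable def av (u : ℝ) : ℝ := Chebyshev.psi (Real.exp u) * Real.exp (-u)

lemma av_nonneg (u : ℝ) : 0 ≤ av u :=
  mul_nonneg (Chebyshev.psi_nonneg _) (Real.exp_pos _).le

lemma av_le (u : ℝ) : av u ≤ Real.log 4 + 4 := by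
  have h := Chebyshev.psi_le_const_mul_self (Real.exp_pos u).le
  have := mul_le_mul_of_nonneg_right h (Real.exp_pos (-u)).le
  rw [mul_assoc, ← Real.exp_add] at this
  simpa [av] using this

lemma av_mono {u v : ℝ} (h : u ≤ v) : av u * Real.exp (-(v - u)) ≤ av v := by
  unfold av
  rw [mul_assoc, ← Real.exp_add, show -u + -(v-u) = -v by ring]
  exact mul_le_mul_of_nonneg_right (Chebyshev.psi_mono (Real.exp_le_exp.2 h)) (Real.exp_pos _).le

lemma av_meas : Measurable av :=
  (Chebyshev.psi_mono.measurable.comp Real.measurable_exp).mul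
    (Real.measurable_exp.comp measurable_neg)

lemma av_neg {u : ℝ} (h : u ≤ 0) : av u = 0 := by
  unfold av
  rw [Chebyshev.psi_eq_zero_of_le_one (Real.exp_le_one_iff.2 h), zero_mul]

noncomputable def M : ℝ := Real.log 4 + 5

lemma av_sub_one (u : ℝ) : ‖((av u - 1 : ℝ) : ℂ)‖ ≤ M := by
  have := av_nonneg u
  have := av_le u
  have := Real.log_nonneg (show (1:ℝ) ≤ 4 by norm_num)
  rw [Complex.norm_real, Real.norm_eq_abs, abs_le]
  unfold M
  constructor <;> linarith

/-- Boundary function. -/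
noncomputable def G (z : ℂ) : ℂ :=
  (ArithmeticFunction.vonMangoldt.LFunctionResidueClassAux (q := 1) 1 (1 + z) - 1) / (1 + z)

lemma G_cont : ContinuousOn G {z | 0 ≤ z.re} := by
  unfold G
  have h := ArithmeticFunction.vonMangoldt.continuousOn_LFunctionResidueClassAux (q := 1) 1
  refine ContinuousOn.div (ContinuousOn.sub (h.comp (by fun_prop) ?_) continuousOn_const)
    (by fun_prop) ?_
  · intro z hz
    simpa using hz
  · intro z hz h0
    have := congrArg Complex.re h0
    have hz' : 0 ≤ z.re := hz
    simp at this
    linarith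

lemma int_exp {z : ℂ} (hz : 0 < z.re) :
    IntegrableOn (fun u : ℝ => ((av u - 1 : ℝ) : ℂ) * cexp (-z * u)) (Ioi 0) := by
  refine Integrable.bdd_mul (c := M)
    (integrableOn_exp_mul_complex_Ioi (a := -z) (by simpa using hz) 0) ?_ ?_
  · exact (Complex.measurable_ofReal.comp (av_meas.sub_const 1)).aestronglyMeasurable
  · exact Eventually.of_forall fun u => av_sub_one u

lemma psi_bigO : (fun n : ℕ => ∑ k ∈ Finset.Icc 1 n, ArithmeticFunction.vonMangoldt k)
    =O[atTop] fun n : ℕ => (n : ℝ) ^ (1:ℝ) := by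
  refine Asymptotics.IsBigO.of_bound (Real.log 4 + 4) (Eventually.of_forall fun n => ?_)
  have h := Chebyshev.psi_le_const_mul_self (Nat.cast_nonneg (α := ℝ) n)
  have h0 := Chebyshev.psi_nonneg n
  unfold Chebyshev.psi at h h0
  rw [Nat.floor_natCast] at h h0
  have e : Finset.Icc 1 n = Finset.Ioc 0 n := by ext; simp; omega
  rw [e, Real.rpow_one, Real.norm_of_nonneg h0, Real.norm_of_nonneg (Nat.cast_nonneg n)]
  exact h

lemma laplace {z : ℂ} (hz : 0 < z.re) :
    ∫ u in Ioi (0:ℝ), ((av u - 1 : ℝ) : ℂ) * cexp (-z * u) = G z := by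
  have hs : 1 < (1 + z).re := by simpa using hz
  have h1 := LSeries_eq_mul_integral_of_nonneg (fun n => ArithmeticFunction.vonMangoldt n)
    (r := 1) zero_le_one hs psi_bigO (fun n => ArithmeticFunction.vonMangoldt_nonneg)
  have h2 := ArithmeticFunction.vonMangoldt.eqOn_LFunctionResidueClassAux (q := 1) (a := 1)
    isUnit_one hs
  have h3 : (fun n : ℕ => (ArithmeticFunction.vonMangoldt.residueClass (1 : ZMod 1) n : ℂ))
      = fun n => (ArithmeticFunction.vonMangoldt n : ℂ) := by
    ext n
    have : (n : ZMod 1) = 1 := Subsingleton.elim _ _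
    simp [ArithmeticFunction.vonMangoldt.residueClass, this]
  rw [h3] at h2
  have h4 : ∫ t in Ioi (1:ℝ), (∑ k ∈ Finset.Icc 1 ⌊t⌋₊,
      ((ArithmeticFunction.vonMangoldt k : ℝ) : ℂ)) * (t:ℂ) ^ (-((1 + z) + 1)) =
      ∫ u in Ioi (0:ℝ), (av u : ℂ) * cexp (-z * u) := by
    have him : Set.image Real.exp (Ioi 0) = Ioi 1 := by
      ext x
      constructor
      · rintro ⟨u, hu, rfl⟩
        exact Real.one_lt_exp_iff.2 hu
      · intro hx
        have hx : 1 < x := hx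
        exact ⟨Real.log x, Real.log_pos hx, Real.exp_log (by linarith)⟩
    rw [← him, integral_image_eq_integral_abs_deriv_smul (f' := Real.exp) measurableSet_Ioi
      (fun x _ => (Real.hasDerivAt_exp x).hasDerivWithinAt) Real.exp_injective.injOn]
    refine setIntegral_congr_fun measurableSet_Ioi fun u _ => ?_
    have e : ∀ n, Finset.Icc 1 n = Finset.Ioc 0 n := by intro n; ext; simp; omega
    have e2 : (∑ k ∈ Finset.Icc 1 ⌊Real.exp u⌋₊,
      ((ArithmeticFunction.vonMangoldt k : ℝ) : ℂ)) = (Chebyshev.psi (Real.exp u) : ℂ) := by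
      rw [e]; simp [Chebyshev.psi]
    simp only [e2, abs_of_pos (Real.exp_pos u), av, Complex.real_smul]
    rw [Complex.cpow_def_of_ne_zero (by simp), ← Complex.ofReal_log (Real.exp_pos u).le,
      Real.log_exp]
    push_cast
    rw [mul_left_comm, ← Complex.exp_add, mul_assoc, ← Complex.exp_add]
    congr 2
    ring
  rw [h4] at h1
  have hne : (1 + z) ≠ 0 := by
    intro h0
    rw [h0] at hs
    norm_num at hs
  have hz0 : z ≠ 0 := by
    intro h0
    simp [h0] at hz
  have h5 : ∫ u in Ioi (0:ℝ), cexp (-z * u) = 1 / z := by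
    rw [integral_exp_mul_complex_Ioi (a := -z) (by simpa using hz)]
    simp
  have h6 : IntegrableOn (fun u : ℝ => cexp (-z * u)) (Ioi 0) :=
    integrableOn_exp_mul_complex_Ioi (a := -z) (by simpa using hz) 0
  have h7 : ∫ u in Ioi (0:ℝ), (av u : ℂ) * cexp (-z * u) =
      (∫ u in Ioi (0:ℝ), ((av u - 1 : ℝ) : ℂ) * cexp (-z * u)) + 1 / z := by
    rw [← h5, ← integral_add (int_exp hz) h6]
    congr 1 with u
    push_cast
    ring
  rw [h7] at h1
  unfold G
  simp only at h2
  rw [h2, h1]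
  simp
  field_simp
  ring

open FourierTransform
open scoped ContDiff

lemma fourier_shift (h : ℝ → ℂ) (u y : ℝ) :
    𝓕 h (u - y) = ∫ t : ℝ, h t * cexp (2 * Real.pi * t * y * I) *
      cexp (-(2 * Real.pi * t * I) * u) := by
  rw [Real.fourier_real_eq_integral_exp_smul]
  congr 1 with t
  rw [smul_eq_mul, mul_assoc (h t), ← Complex.exp_add, mul_comm]
  congr 2
  push_cast
  ring

/-- Continuous extension of `G` to the plane. -/
noncomputable def Gc (z : ℂ) : ℂ := G ((max z.re 0 : ℝ) + z.im * I)

lemma Gc_cont : Continuous Gc := by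
  unfold Gc
  refine G_cont.comp_continuous (by fun_prop) fun z => ?_
  simp

lemma step1 {h : ℝ → ℂ} (hc : Continuous h) (hs : HasCompactSupport h) {ε : ℝ} (hε : 0 < ε)
    (y : ℝ) :
    ∫ u in Ioi (0:ℝ), ((av u - 1 : ℝ) : ℂ) * cexp (-ε * u) * 𝓕 h (u - y) =
    ∫ t : ℝ, h t * cexp (2 * Real.pi * t * y * I) * Gc (ε + 2 * Real.pi * t * I) := by
  have hint : Integrable h := hc.integrable_of_hasCompactSupport hs
  simp_rw [fourier_shift, ← integral_const_mul]
  rw [integral_integral_swap]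
  · congr 1 with t
    have hz : 0 < ((ε : ℂ) + 2 * Real.pi * t * I).re := by simpa using hε
    have e : Gc (ε + 2 * Real.pi * t * I) = G (ε + 2 * Real.pi * t * I) := by
      unfold Gc
      congr 1
      simp [hε.le]
    rw [e, ← laplace hz, ← integral_const_mul]
    congr 1 with u
    rw [show -((ε : ℂ) + 2 * Real.pi * t * I) * u = -ε * u + (-(2 * Real.pi * t * I) * u) by ring,
      Complex.exp_add]
    ring
  · have hB : IntegrableOn (fun u : ℝ => ((av u - 1 : ℝ) : ℂ) * cexp (-ε * u)) (Ioi 0) :=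
      int_exp (z := ε) (by simpa using hε)
    have hP := Integrable.mul_prod hB hint
    have hm : Continuous fun p : ℝ × ℝ => cexp (2 * Real.pi * p.2 * y * I) *
      cexp (-(2 * Real.pi * p.2 * I) * p.1) := by fun_prop
    have := hP.bdd_mul (c := 1) hm.aestronglyMeasurable (Eventually.of_forall fun p => by
      rw [norm_mul, Complex.norm_exp, Complex.norm_exp]
      simp)
    refine this.congr (Eventually.of_forall fun p => ?_)
    simp only [Function.uncurry]
    ring

lemma lemB {h : ℝ → ℂ} (hc : Continuous h) (hs : HasCompactSupport h)
    (hF : Integrable (𝓕 h)) :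
    Tendsto (fun y : ℝ => ∫ u in Ioi (0:ℝ), ((av u - 1 : ℝ) : ℂ) * 𝓕 h (u - y)) atTop (𝓝 0) := by
  have key : ∀ y : ℝ, ∫ u in Ioi (0:ℝ), ((av u - 1 : ℝ) : ℂ) * 𝓕 h (u - y) =
      ∫ t : ℝ, h t * cexp (2 * Real.pi * t * y * I) * Gc (2 * Real.pi * t * I) := by
    intro y
    have hFy : Integrable (fun u => 𝓕 h (u - y)) := hF.comp_sub_right y
    have L1 : Tendsto (fun ε : ℝ => ∫ u in Ioi (0:ℝ), ((av u - 1 : ℝ) : ℂ) * cexp (-ε * u) *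
        𝓕 h (u - y)) (𝓝[>] 0)
        (𝓝 (∫ u in Ioi (0:ℝ), ((av u - 1 : ℝ) : ℂ) * 𝓕 h (u - y))) := by
      refine tendsto_integral_filter_of_dominated_convergence (fun u => M * ‖𝓕 h (u - y)‖)
        ?_ ?_ ?_ ?_
      · refine Eventually.of_forall fun ε => ?_
        refine AEStronglyMeasurable.mul (AEStronglyMeasurable.mul ?_ ?_)
          hFy.aestronglyMeasurable.restrict
        · exact (Complex.measurable_ofReal.comp (av_meas.sub_const 1)).aestronglyMeasurable
        · exact Continuous.aestronglyMeasurable (by fun_prop)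
      · filter_upwards [self_mem_nhdsWithin] with ε hε
        refine (ae_restrict_iff' measurableSet_Ioi).2 (Eventually.of_forall fun u hu => ?_)
        rw [norm_mul, norm_mul]
        refine mul_le_mul_of_nonneg_right ?_ (norm_nonneg _)
        have : ‖cexp (-ε * u)‖ ≤ 1 := by
          rw [Complex.norm_exp, Real.exp_le_one_iff]
          have : (0:ℝ) < ε := hε
          have : (0:ℝ) < u := hu
          simp
          positivity
        calc _ ≤ M * 1 := mul_le_mul (av_sub_one u) this (norm_nonneg _)
              ((norm_nonneg _).trans (av_sub_one u))
          _ = M := mul_one _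
      · exact (hFy.norm.const_mul M).restrict
      · refine Eventually.of_forall fun u => ?_
        have : Continuous fun ε : ℝ => ((av u - 1 : ℝ) : ℂ) * cexp (-ε * u) * 𝓕 h (u - y) := by
          fun_prop
        have := (this.tendsto 0).mono_left (nhdsWithin_le_nhds (s := Ioi 0))
        simpa using this
    have L2 : Tendsto (fun ε : ℝ => ∫ t : ℝ, h t * cexp (2 * Real.pi * t * y * I) *
        Gc (ε + 2 * Real.pi * t * I)) (𝓝[>] 0)
        (𝓝 (∫ t : ℝ, h t * cexp (2 * Real.pi * t * y * I) * Gc (2 * Real.pi * t * I))) := by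
      have hcont : Continuous (Function.uncurry fun (ε t : ℝ) =>
          h t * cexp (2 * Real.pi * t * y * I) * Gc (ε + 2 * Real.pi * t * I)) := by
        have := Gc_cont
        unfold Function.uncurry
        fun_prop
      have hcc := continuous_parametric_integral_of_continuous (μ := volume) hcont hs
      have e : ∀ ε : ℝ, ∫ t in tsupport h, h t * cexp (2 * Real.pi * t * y * I) *
          Gc (ε + 2 * Real.pi * t * I) = ∫ t : ℝ, h t * cexp (2 * Real.pi * t * y * I) *
          Gc (ε + 2 * Real.pi * t * I) := by
        intro ε
        refine setIntegral_eq_integral_of_forall_compl_eq_zero fun t ht => ?_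
        simp [image_eq_zero_of_notMem_tsupport ht]
      simp_rw [e] at hcc
      have := (hcc.tendsto 0).mono_left (nhdsWithin_le_nhds (s := Ioi 0))
      simpa using this
    refine tendsto_nhds_unique L1 (L2.congr' ?_)
    filter_upwards [self_mem_nhdsWithin] with ε hε
    exact (step1 hc hs hε y).symm
  simp_rw [key]
  have RL := Real.zero_at_infty_fourier (fun t : ℝ => h t * Gc (2 * Real.pi * t * I))
  have := RL.comp (tendsto_neg_atTop_atBot.mono_right atBot_le_cocompact)
  refine this.congr fun y => ?_
  simp only [Function.comp, Real.fourier_real_eq_integral_exp_smul]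
  congr 1 with t
  have e : ((-2 * Real.pi * t * -y : ℝ) : ℂ) * I = 2 * Real.pi * t * y * I := by
    push_cast
    ring
  rw [smul_eq_mul, e]
  ring

/-- existence of a kernel -/
lemma exists_kernel : ∃ (h : ℝ → ℂ) (k : ℝ → ℝ), Continuous h ∧ HasCompactSupport h ∧
    (∀ v, 𝓕 h v = k v) ∧ (∀ v, 0 ≤ k v) ∧ Integrable k ∧ 0 < ∫ v, k v := by
  let b : ContDiffBump (0:ℝ) := ⟨1, 2, by norm_num, by norm_num⟩
  let f : ℝ → ℂ := fun t => (b t : ℂ)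
  have hfc : HasCompactSupport f := b.hasCompactSupport.comp_left Complex.ofReal_zero
  have hfs : ContDiff ℝ ∞ f := Complex.ofRealCLM.contDiff.comp b.contDiff
  let F : SchwartzMap ℝ ℂ := hfc.toSchwartzMap hfs
  have hFf : (F : ℝ → ℂ) = f := rfl
  have hfi : Integrable f := hfs.continuous.integrable_of_hasCompactSupport hfc
  have hconj : ∀ v, (starRingEnd ℂ) (𝓕 f v) = 𝓕 f v := by
    intro v
    rw [Real.fourier_real_eq_integral_exp_smul, ← integral_conj,
      ← integral_neg_eq_self]
    congr 1 with t
    have : b (-t) = b t := b.neg t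
    simp only [f, smul_eq_mul, map_mul, Complex.conj_ofReal, ← Complex.exp_conj, Complex.conj_I,
      this]
    congr 2
    push_cast
    ring
  have hsq : ∀ v, 𝓕 f v * 𝓕 f v = ((‖𝓕 f v‖ ^ 2 : ℝ) : ℂ) := by
    intro v
    rw [← Complex.normSq_eq_norm_sq, Complex.normSq_eq_conj_mul_self, hconj]
  have hFS : 𝓕 f = (𝓕 F : SchwartzMap ℝ ℂ) := by
    rw [SchwartzMap.fourier_coe]
    rfl
  have hki : Integrable (fun v => ‖𝓕 f v‖ ^ 2) := by
    rw [hFS]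
    have := (SchwartzMap.memLp (𝓕 F : SchwartzMap ℝ ℂ) 2).integrable_norm_pow (by norm_num)
    simpa using this
  refine ⟨convolution f f (ContinuousLinearMap.mul ℂ ℂ) volume, fun v => ‖𝓕 f v‖ ^ 2,
    ?_, ?_, ?_, ?_, hki, ?_⟩
  · exact hfc.continuous_convolution_right _ hfi.locallyIntegrable hfs.continuous
  · exact hfc.convolution _ hfc
  · intro v
    rw [Real.fourier_mul_convolution_eq hfi hfi, hsq]
  · intro v
    positivity
  · have hcont : Continuous (fun v => ‖𝓕 f v‖ ^ 2) := by
      rw [hFS]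
      exact (SchwartzMap.continuous _).norm.pow 2
    have h0 : 𝓕 f 0 ≠ 0 := by
      rw [Real.fourier_real_eq_integral_exp_smul]
      have hp : 0 < ∫ t, b t := b.integral_pos
      have : ∫ v : ℝ, cexp (((-2 * Real.pi * v * 0 : ℝ) : ℂ) * I) • f v = ((∫ t, b t : ℝ) : ℂ) := by
        rw [← integral_complex_ofReal]
        congr 1 with t
        simp [f]
      rw [this]
      exact_mod_cast hp.ne'
    exact integral_pos_of_integrable_nonneg_nonzero (x := 0) hcont hki
      (fun v => by positivity) (by simpa using h0)

lemma fourier_scale (h : ℝ → ℂ) {l : ℝ} (hl : 0 < l) (v : ℝ) :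
    𝓕 (fun t => h (t / l)) v = l * 𝓕 h (l * v) := by
  rw [Real.fourier_real_eq_integral_exp_smul, Real.fourier_real_eq_integral_exp_smul]
  have := Measure.integral_comp_div
    (fun t : ℝ => cexp (((-2 * Real.pi * t * (l * v) : ℝ) : ℂ) * I) • h t) l
  rw [abs_of_pos hl, Complex.real_smul] at this
  rw [← this]
  congr 1 with t
  rw [show -2 * Real.pi * (t / l) * (l * v) = -2 * Real.pi * t * v by field_simp]

lemma avg {h : ℝ → ℂ} {k : ℝ → ℝ} (hc : Continuous h) (hs : HasCompactSupport h)
    (hk : ∀ v, 𝓕 h v = k v) (hki : Integrable k) {l : ℝ} (hl : 0 < l) :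
    Tendsto (fun y : ℝ => ∫ v, av (y + v / l) * k v) atTop (𝓝 (∫ v, k v)) := by
  have hF : ∀ v, 𝓕 (fun t => h (t / l)) v = ((l * k (l * v) : ℝ) : ℂ) := by
    intro v
    rw [fourier_scale h hl, hk]
    push_cast
    rfl
  have hB := lemB (h := fun t => h (t / l)) (hc.comp (by fun_prop))
    (by
      have := hs.comp_homeomorph (Homeomorph.mulRight₀ l⁻¹ (by positivity))
      simpa [Function.comp_def, div_eq_mul_inv] using this)
    (by
      rw [funext hF]
      exact ((hki.comp_mul_left' hl.ne').const_mul l).ofReal)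
  let ι : ℝ → ℝ := (Ioi (0:ℝ)).indicator 1
  have e1 : ∀ y : ℝ, ∫ u in Ioi (0:ℝ), ((av u - 1 : ℝ) : ℂ) * 𝓕 (fun t => h (t / l)) (u - y) =
      ((∫ v, (av (y + v / l) - ι (y + v / l)) * k v : ℝ) : ℂ) := by
    intro y
    simp_rw [hF, ← Complex.ofReal_mul]
    rw [integral_complex_ofReal]
    congr 1
    have s1 := Measure.integral_comp_mul_left
      (fun v => (av (y + v / l) - ι (y + v / l)) * k v) l
    rw [abs_of_pos (inv_pos.2 hl), smul_eq_mul] at s1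
    have s2 := integral_sub_right_eq_self (μ := volume)
      (fun v => (av (y + (l * v) / l) - ι (y + (l * v) / l)) * k (l * v)) y
    rw [s1] at s2
    have s3 : ∫ v, (av (y + v / l) - ι (y + v / l)) * k v = l * ∫ x : ℝ,
        (av (y + (l * (x - y)) / l) - ι (y + (l * (x - y)) / l)) * k (l * (x - y)) := by
      rw [s2]
      field_simp
    rw [s3, ← integral_const_mul, ← integral_indicator measurableSet_Ioi]
    congr 1 with u
    have : y + l * (u - y) / l = u := by field_simp; ring
    rw [this]
    by_cases hu : u ∈ Ioi (0:ℝ)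
    · simp [ι, hu]
      ring
    · have : av u = 0 := av_neg (not_lt.1 hu)
      simp [ι, hu, this]
  simp_rw [e1] at hB
  have hB' : Tendsto (fun y : ℝ => ∫ v, (av (y + v / l) - ι (y + v / l)) * k v) atTop (𝓝 0) := by
    have := (Complex.continuous_re.tendsto 0).comp hB
    simpa only [Function.comp_def, Complex.ofReal_re, Complex.zero_re] using this
  have hιm : Measurable ι := measurable_one.indicator measurableSet_Ioi
  have hι1 : ∀ u, ‖ι u‖ ≤ 1 := by
    intro u
    by_cases hu : u ∈ Ioi (0:ℝ) <;> simp [ι, hu]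
  have hI : Tendsto (fun y : ℝ => ∫ v, ι (y + v / l) * k v) atTop (𝓝 (∫ v, k v)) := by
    refine tendsto_integral_filter_of_dominated_convergence (fun v => ‖k v‖) ?_ ?_ hki.norm ?_
    · refine Eventually.of_forall fun y => ?_
      exact (hιm.comp (by fun_prop)).aestronglyMeasurable.mul hki.aestronglyMeasurable
    · refine Eventually.of_forall fun y => Eventually.of_forall fun v => ?_
      rw [norm_mul]
      exact mul_le_of_le_one_left (norm_nonneg _) (hι1 _)
    · refine Eventually.of_forall fun v => ?_
      refine tendsto_const_nhds.congr' ?_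
      filter_upwards [eventually_gt_atTop (-(v / l))] with y hy
      have : y + v / l ∈ Ioi (0:ℝ) := by simp only [mem_Ioi]; linarith
      simp [ι, this]
  have := hB'.add hI
  rw [zero_add] at this
  refine this.congr fun y => ?_
  have i1 : Integrable fun v => (av (y + v / l)) * k v := by
    refine hki.bdd_mul (c := Real.log 4 + 4) (av_meas.comp (by fun_prop)).aestronglyMeasurable
      (Eventually.of_forall fun v => ?_)
    rw [Real.norm_of_nonneg (av_nonneg _)]
    exact av_le _
  have i2 : Integrable fun v => (ι (y + v / l)) * k v := by
    exact hki.bdd_mul (c := 1) (hιm.comp (by fun_prop)).aestronglyMeasurable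
      (Eventually.of_forall fun v => hι1 _)
  have i3 : Integrable fun v => (av (y + v / l) - ι (y + v / l)) * k v := by
    simp_rw [sub_mul]
    exact i1.sub i2
  rw [← integral_add i3 i2]
  congr 1 with v
  ring

lemma bounds {η : ℝ} (h0 : 0 < η) (h1 : η < 1) : ∀ᶠ y in atTop,
    av y ≤ Real.exp (2 * η) * (1 + η) / (1 - η) ∧
    Real.exp (-(2 * η)) * (1 - η - M * η) ≤ av y := by
  obtain ⟨h, k, hc, hs, hk, hkn, hki, hpos⟩ := exists_kernel
  set c := ∫ v, k v with hcdef
  have hT : ∃ T : ℝ, 0 < T ∧ c * (1 - η) < ∫ v in Ioc (-T) T, k v := by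
    have ht := intervalIntegral_tendsto_integral hki tendsto_neg_atTop_atBot tendsto_id
    have hlt : c * (1 - η) < c := by nlinarith
    obtain ⟨T, hT1, hT2⟩ := ((ht.eventually_const_lt hlt).and (eventually_gt_atTop 0)).exists
    refine ⟨T, hT2, ?_⟩
    rwa [intervalIntegral.integral_of_le (by simp only [id]; linarith)] at hT1
  obtain ⟨T, hT0, hT⟩ := hT
  set l := T / η with hldef
  have hl : 0 < l := by positivity
  have hA := avg hc hs hk hki hl
  rw [← hcdef] at hA
  have hsmall : ∀ v ∈ Ioc (-T) T, -η ≤ v / l ∧ v / l ≤ η := by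
    intro v hv
    have hTl : η * l = T := by rw [hldef]; field_simp
    constructor
    · rw [le_div_iff₀ hl]; linarith [hv.1]
    · rw [div_le_iff₀ hl]; linarith [hv.2]
  have hint : ∀ y, Integrable fun v => (av (y + v / l)) * k v := by
    intro y
    refine hki.bdd_mul (c := Real.log 4 + 4) (av_meas.comp (by fun_prop)).aestronglyMeasurable
      (Eventually.of_forall fun v => ?_)
    rw [Real.norm_of_nonneg (av_nonneg _)]
    exact av_le _
  have hsplit : ∀ f : ℝ → ℝ, Integrable f →
      (∫ v in Ioc (-T) T, f v) + ∫ v in (Ioc (-T) T)ᶜ, f v = ∫ v, f v :=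
    fun f hf => integral_add_compl measurableSet_Ioc hf
  have hcin : ∫ v in Ioc (-T) T, k v ≤ c :=
    setIntegral_le_integral hki (Eventually.of_forall hkn)
  have hcout : ∫ v in (Ioc (-T) T)ᶜ, k v ≤ c * η := by
    have := hsplit k hki
    linarith
  -- upper
  have up : ∀ᶠ y in atTop, av (y - η) ≤ Real.exp (2 * η) * (1 + η) / (1 - η) := by
    filter_upwards [hA.eventually_lt_const (show c < c * (1 + η) by nlinarith)] with y hy
    have b1 : ∫ v in Ioc (-T) T, (av (y - η) * Real.exp (-(2 * η))) * k v ≤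
        ∫ v in Ioc (-T) T, av (y + v / l) * k v := by
      refine setIntegral_mono_on (hki.const_mul _).integrableOn (hint y).integrableOn
        measurableSet_Ioc fun v hv => mul_le_mul_of_nonneg_right ?_ (hkn v)
      obtain ⟨q1, q2⟩ := hsmall v hv
      refine le_trans ?_ (av_mono (show y - η ≤ y + v / l by linarith))
      exact mul_le_mul_of_nonneg_left (Real.exp_le_exp.2 (by linarith)) (av_nonneg _)
    have b2 : ∫ v in Ioc (-T) T, av (y + v / l) * k v ≤ ∫ v, av (y + v / l) * k v :=
      setIntegral_le_integral (hint y)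
        (Eventually.of_forall fun v => mul_nonneg (av_nonneg _) (hkn v))
    rw [integral_const_mul] at b1
    have b3 : av (y - η) * Real.exp (-(2 * η)) * (c * (1 - η)) ≤ c * (1 + η) := by
      have : 0 ≤ av (y - η) * Real.exp (-(2 * η)) := mul_nonneg (av_nonneg _) (Real.exp_pos _).le
      have := mul_le_mul_of_nonneg_left hT.le this
      linarith
    have b4 : av (y - η) * Real.exp (-(2 * η)) * (1 - η) ≤ 1 + η := by
      refine le_of_mul_le_mul_left ?_ hpos
      linarith
    rw [le_div_iff₀ (by linarith)]
    have b5 := mul_le_mul_of_nonneg_left b4 (Real.exp_pos (2 * η)).le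
    rw [Real.exp_neg] at b5
    field_simp at b5
    linarith
  have lo : ∀ᶠ y in atTop, Real.exp (-(2 * η)) * (1 - η - M * η) ≤ av (y + η) := by
    filter_upwards [hA.eventually_const_lt (show c * (1 - η) < c by nlinarith)] with y hy
    have b1 : ∫ v in Ioc (-T) T, av (y + v / l) * k v ≤
        ∫ v in Ioc (-T) T, (av (y + η) * Real.exp (2 * η)) * k v := by
      refine setIntegral_mono_on (hint y).integrableOn (hki.const_mul _).integrableOn
        measurableSet_Ioc fun v hv => mul_le_mul_of_nonneg_right ?_ (hkn v)
      obtain ⟨q1, q2⟩ := hsmall v hv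
      have m := av_mono (show y + v / l ≤ y + η by linarith)
      have m2 : av (y + v / l) * Real.exp (-(2 * η)) ≤ av (y + η) := by
        refine le_trans ?_ m
        exact mul_le_mul_of_nonneg_left (Real.exp_le_exp.2 (by linarith)) (av_nonneg _)
      rw [Real.exp_neg, ← div_eq_mul_inv, div_le_iff₀ (Real.exp_pos _)] at m2
      exact m2
    have b2 : ∫ v in (Ioc (-T) T)ᶜ, av (y + v / l) * k v ≤
        ∫ v in (Ioc (-T) T)ᶜ, M * k v := by
      refine setIntegral_mono_on (hint y).integrableOn (hki.const_mul _).integrableOn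
        measurableSet_Ioc.compl fun v hv => mul_le_mul_of_nonneg_right ?_ (hkn v)
      have := av_le (y + v / l)
      unfold M
      linarith
    rw [integral_const_mul] at b1 b2
    have hM : 0 ≤ M := (norm_nonneg _).trans (av_sub_one 0)
    have b3 := mul_le_mul_of_nonneg_left hcout hM
    have b4 := mul_le_mul_of_nonneg_left hcin
      (mul_nonneg (av_nonneg (y + η)) (Real.exp_pos (2 * η)).le)
    have b5 := hsplit _ (hint y)
    have b6 : 1 - η - M * η ≤ av (y + η) * Real.exp (2 * η) := by
      refine le_of_mul_le_mul_left ?_ hpos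
      linarith
    rw [Real.exp_neg, mul_comm, ← div_eq_mul_inv, div_le_iff₀ (Real.exp_pos _)]
    exact b6
  have up' := (tendsto_atTop_add_const_right atTop η tendsto_id).eventually up
  have lo' := (tendsto_atTop_add_const_right atTop (-η) tendsto_id).eventually lo
  filter_upwards [up', lo'] with y hu hv
  simp only [id, add_sub_cancel_right, neg_add_cancel_right] at hu hv
  exact ⟨hu, hv⟩

lemma av_tendsto : Tendsto av atTop (𝓝 1) := by
  have c1 : Tendsto (fun η : ℝ => Real.exp (2 * η) * (1 + η) / (1 - η)) (𝓝[>] 0) (𝓝 1) := by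
    have : ContinuousAt (fun η : ℝ => Real.exp (2 * η) * (1 + η) / (1 - η)) 0 :=
      ContinuousAt.div (by fun_prop) (by fun_prop) (by norm_num)
    have := this.tendsto.mono_left (nhdsWithin_le_nhds (s := Ioi 0))
    simpa using this
  have c2 : Tendsto (fun η : ℝ => Real.exp (-(2 * η)) * (1 - η - M * η)) (𝓝[>] 0) (𝓝 1) := by
    have : Continuous (fun η : ℝ => Real.exp (-(2 * η)) * (1 - η - M * η)) := by fun_prop
    have := (this.tendsto 0).mono_left (nhdsWithin_le_nhds (s := Ioi 0))
    simpa using this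
  have c3 : ∀ᶠ η : ℝ in 𝓝[>] 0, 0 < η ∧ η < 1 :=
    Ioo_mem_nhdsGT one_pos
  refine tendsto_order.2 ⟨fun b hb => ?_, fun b hb => ?_⟩
  · obtain ⟨η, hη, h0, h1⟩ := ((c2.eventually_const_lt hb).and c3).exists
    filter_upwards [bounds h0 h1] with y hy
    exact hη.trans_le hy.2
  · obtain ⟨η, hη, h0, h1⟩ := ((c1.eventually_lt_const hb).and c3).exists
    filter_upwards [bounds h0 h1] with y hy
    exact hy.1.trans_lt hη

lemma psi_tendsto : Tendsto (fun x : ℝ => Chebyshev.psi x / x) atTop (𝓝 1) := by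
  refine (av_tendsto.comp Real.tendsto_log_atTop).congr' ?_
  filter_upwards [eventually_gt_atTop 0] with x hx
  simp only [Function.comp, av, Real.exp_log hx, Real.exp_neg]
  rfl

end PNTAux

/-- **Prime Number Theorem, Chebyshev form.** `ψ(x) ∼ x` as `x → +∞`, i.e.
`ψ(x)/x → 1` as `x → +∞`, where `ψ(x) = ∑_{1 ≤ n < x} Λ(n)` is the (left-continuous) Chebyshev
summatory function of the von Mangoldt function `Λ`. -/
theorem stmt16 (ψ : ℝ → ℝ)
    (hψ : ∀ x : ℝ, ψ x = ∑ n ∈ Finset.Ico 1 ⌈x⌉₊, ArithmeticFunction.vonMangoldt n) :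
    Filter.Tendsto (fun x : ℝ => ψ x / x) Filter.atTop (nhds 1) := by
  have hlow : Tendsto (fun x : ℝ => Chebyshev.psi (x - 1) / x) atTop (nhds 1) := by
    have h1 := PNTAux.psi_tendsto.comp (tendsto_atTop_add_const_right atTop (-1 : ℝ) tendsto_id)
    have h2 : Tendsto (fun x : ℝ => 1 - x⁻¹) atTop (nhds 1) := by
      simpa using tendsto_inv_atTop_zero.const_sub (1 : ℝ)
    have h3 := h1.mul h2
    rw [one_mul] at h3
    refine h3.congr' ?_
    filter_upwards [eventually_gt_atTop 1] with x hx
    have a1 : x - 1 ≠ 0 := by linarith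
    have a2 : x ≠ 0 := by linarith
    simp only [Function.comp, id, ← sub_eq_add_neg]
    field_simp
  refine tendsto_of_tendsto_of_tendsto_of_le_of_le' hlow PNTAux.psi_tendsto ?_ ?_
  · filter_upwards [eventually_gt_atTop 1] with x hx
    refine div_le_div_of_nonneg_right ?_ (by linarith)
    rw [hψ]
    unfold Chebyshev.psi
    refine Finset.sum_le_sum_of_subset_of_nonneg ?_
      fun _ _ _ => ArithmeticFunction.vonMangoldt_nonneg
    intro n hn
    rw [Finset.mem_Ioc] at hn
    have := (Nat.le_floor_iff (by linarith : (0:ℝ) ≤ x - 1)).1 hn.2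
    rw [Finset.mem_Ico, Nat.lt_ceil]
    exact ⟨hn.1, by linarith⟩
  · filter_upwards [eventually_gt_atTop 1] with x hx
    refine div_le_div_of_nonneg_right ?_ (by linarith)
    rw [hψ]
    unfold Chebyshev.psi
    refine Finset.sum_le_sum_of_subset_of_nonneg ?_
      fun _ _ _ => ArithmeticFunction.vonMangoldt_nonneg
    intro n hn
    rw [Finset.mem_Ico, Nat.lt_ceil] at hn
    rw [Finset.mem_Ioc, Nat.le_floor_iff (by linarith)]
    exact ⟨hn.1, hn.2.le⟩
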